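/- Let (c, ρ, θ, u) be a smooth classical solution of the mesoscopic two-phase Navier–Stokes system on [0,T], spatially 1-periodic, with 0 ≤ c ≤ 1, ρ̲ ≤ ρ ≤ ρ̄ for constants 0 < ρ̲ ≤ ρ̄, θ > 0, and suppose that for constants C₅, C₉ > 0: sup_{t∈[0,T]} ∫₀¹σ(t,x)²dx + ∫₀ᵀ∫₀¹(∂ₓσ)² ≤ C₅ and ∫₀ᵀ‖∂ₓu(t,·)‖_{L^∞(0,1)}²dt ≤ C₉, where σ = μ(c)∂ₓu − (γ(c)−1)ρθ. Then there exists C₁₁ > 0, depending only on μ_±, γ_±, c_{v,±}, ρ̲, ρ̄, C₅ and C₉ (and in particular not on any norm of σ(0,·) beyond C₅), such that for every t ∈ [0,T]: min(1,t)·∫₀¹(∂ₓσ(t,x))²dx + ∫₀ᵗ min(1,s)·∫₀¹(D_tσ(s,x))² dx ds ≤ C₁₁, where D_tσ = ∂ₜσ + u∂ₓσ. -/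

import Mathlib

open Set Function MeasureTheory intervalIntegral

/-- Partial derivative in time of a function of `(t, x)`. -/
noncomputable def pdt (f : ℝ → ℝ → ℝ) (t x : ℝ) : ℝ := deriv (fun s => f s x) t

/-- Partial derivative in space of a function of `(t, x)`. -/
noncomputable def pdx (f : ℝ → ℝ → ℝ) (t x : ℝ) : ℝ := deriv (fun y => f t y) x

/-- Affine interpolation of a coefficient between the two phases:
`aff a b c = c·a + (1−c)·b` (so `μ(c) = aff μ₊ μ₋ c`, etc.). -/
def affc (a b s : ℝ) : ℝ := s * a + (1 - s) * b

/-- Cauchy stress `σ = μ(c)∂ₓu − (γ(c)−1)ρθ` of the mesoscopic two-phase model. -/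
noncomputable def sigm (μp μm γp γm : ℝ) (c ρ θ u : ℝ → ℝ → ℝ) (t x : ℝ) : ℝ :=
  affc μp μm (c t x) * pdx u t x - (affc γp γm (c t x) - 1) * ρ t x * θ t x

/-- Specific total energy `E = u²/2 + c_v(c)θ`. -/
noncomputable def Etot (kp km : ℝ) (c θ u : ℝ → ℝ → ℝ) (t x : ℝ) : ℝ :=
  u t x ^ 2 / 2 + affc kp km (c t x) * θ t x

/-- Admissible constants: `μ_± > 0`, `γ_± > 1`, `c_{v,±} > 0`. -/
def GoodConsts (μp μm γp γm kp km : ℝ) : Prop :=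
  0 < μp ∧ 0 < μm ∧ 1 < γp ∧ 1 < γm ∧ 0 < kp ∧ 0 < km

/-- The mesoscopic two-phase Navier–Stokes system on the one-dimensional torus:
spatial 1-periodicity together with the transport, mass, momentum and total
energy equations, satisfied pointwise on `[0,T] × ℝ`. -/
def MesoEqns (μp μm γp γm kp km T : ℝ) (c ρ θ u : ℝ → ℝ → ℝ) : Prop :=
  (∀ t x : ℝ, c t (x + 1) = c t x) ∧ (∀ t x : ℝ, ρ t (x + 1) = ρ t x) ∧
  (∀ t x : ℝ, θ t (x + 1) = θ t x) ∧ (∀ t x : ℝ, u t (x + 1) = u t x) ∧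
  (∀ t ∈ Icc (0:ℝ) T, ∀ x : ℝ, pdt c t x + u t x * pdx c t x = 0) ∧
  (∀ t ∈ Icc (0:ℝ) T, ∀ x : ℝ,
    pdt ρ t x + pdx (fun s y => ρ s y * u s y) t x = 0) ∧
  (∀ t ∈ Icc (0:ℝ) T, ∀ x : ℝ,
    pdt (fun s y => ρ s y * u s y) t x + pdx (fun s y => ρ s y * u s y ^ 2) t x
      = pdx (sigm μp μm γp γm c ρ θ u) t x) ∧
  (∀ t ∈ Icc (0:ℝ) T, ∀ x : ℝ,
    pdt (fun s y => ρ s y * Etot kp km c θ u s y) t x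
      + pdx (fun s y => ρ s y * Etot kp km c θ u s y * u s y) t x
      = pdx (fun s y => sigm μp μm γp γm c ρ θ u s y * u s y) t x)

/-- Smooth function of `(t, x)`. -/
def SmF (f : ℝ → ℝ → ℝ) : Prop := ContDiff ℝ (⊤ : ℕ∞) (uncurry f)

namespace SmF

variable {f g : ℝ → ℝ → ℝ}

theorem diffAt (hf : SmF f) (p : ℝ × ℝ) : DifferentiableAt ℝ (uncurry f) p :=
  (ContDiff.differentiable hf (by simp)) p

theorem hdt' (hf : SmF f) (t x : ℝ) :
    HasDerivAt (fun s => f s x) (fderiv ℝ (uncurry f) (t, x) (1, 0)) t := by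
  have h1 : HasFDerivAt (uncurry f) (fderiv ℝ (uncurry f) (t, x)) (t, x) :=
    (hf.diffAt (t, x)).hasFDerivAt
  have h2 : HasDerivAt (fun s : ℝ => (s, x)) ((1 : ℝ), (0 : ℝ)) t :=
    (hasDerivAt_id t).prodMk (hasDerivAt_const t x)
  exact h1.comp_hasDerivAt t h2

theorem hdx' (hf : SmF f) (t x : ℝ) :
    HasDerivAt (fun y => f t y) (fderiv ℝ (uncurry f) (t, x) (0, 1)) x := by
  have h1 : HasFDerivAt (uncurry f) (fderiv ℝ (uncurry f) (t, x)) (t, x) :=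
    (hf.diffAt (t, x)).hasFDerivAt
  have h2 : HasDerivAt (fun y : ℝ => (t, y)) ((0 : ℝ), (1 : ℝ)) x :=
    (hasDerivAt_const x t).prodMk (hasDerivAt_id x)
  exact h1.comp_hasDerivAt x h2

theorem pdt_eq (hf : SmF f) (t x : ℝ) :
    pdt f t x = fderiv ℝ (uncurry f) (t, x) (1, 0) := (hf.hdt' t x).deriv

theorem pdx_eq (hf : SmF f) (t x : ℝ) :
    pdx f t x = fderiv ℝ (uncurry f) (t, x) (0, 1) := (hf.hdx' t x).deriv

theorem hdt (hf : SmF f) (t x : ℝ) : HasDerivAt (fun s => f s x) (pdt f t x) t := by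
  rw [hf.pdt_eq]; exact hf.hdt' t x

theorem hdx (hf : SmF f) (t x : ℝ) : HasDerivAt (fun y => f t y) (pdx f t x) x := by
  rw [hf.pdx_eq]; exact hf.hdx' t x

theorem fderivC (hf : SmF f) : ContDiff ℝ (⊤ : ℕ∞) (fderiv ℝ (uncurry f)) :=
  ContDiff.fderiv_right hf (by simp)

theorem smPdt (hf : SmF f) : SmF (pdt f) := by
  have h : uncurry (pdt f) = fun p => fderiv ℝ (uncurry f) p (1, 0) := by
    funext p; exact hf.pdt_eq p.1 p.2
  unfold SmF
  rw [h]
  exact hf.fderivC.clm_apply contDiff_const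

theorem smPdx (hf : SmF f) : SmF (pdx f) := by
  have h : uncurry (pdx f) = fun p => fderiv ℝ (uncurry f) p (0, 1) := by
    funext p; exact hf.pdx_eq p.1 p.2
  unfold SmF
  rw [h]
  exact hf.fderivC.clm_apply contDiff_const

theorem pdt_pdx (hf : SmF f) (t x : ℝ) : pdt (pdx f) t x = pdx (pdt f) t x := by
  have h1 : uncurry (pdt f) = fun p => fderiv ℝ (uncurry f) p (1, 0) := by
    funext p; exact hf.pdt_eq p.1 p.2
  have h2 : uncurry (pdx f) = fun p => fderiv ℝ (uncurry f) p (0, 1) := by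
    funext p; exact hf.pdx_eq p.1 p.2
  have hd : DifferentiableAt ℝ (fderiv ℝ (uncurry f)) (t, x) :=
    (hf.fderivC.differentiable (by simp)) _
  have hs : IsSymmSndFDerivAt ℝ (uncurry f) (t, x) :=
    ContDiffAt.isSymmSndFDerivAt (n := (⊤ : ℕ∞)) (ContDiff.contDiffAt hf)
      (by rw [minSmoothness_of_isRCLikeNormedField]; exact WithTop.coe_le_coe.2 (le_top : (2 : ℕ∞) ≤ ⊤))
  rw [hf.smPdx.pdt_eq, hf.smPdt.pdx_eq, h1, h2, fderiv_clm_apply hd (by fun_prop),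
    fderiv_clm_apply hd (by fun_prop)]
  simp
  exact hs _ _

theorem cont (hf : SmF f) : Continuous (uncurry f) := ContDiff.continuous hf

theorem add (hf : SmF f) (hg : SmF g) : SmF (fun t x => f t x + g t x) :=
  ContDiff.add hf hg

theorem sub (hf : SmF f) (hg : SmF g) : SmF (fun t x => f t x - g t x) :=
  ContDiff.sub hf hg

theorem mul (hf : SmF f) (hg : SmF g) : SmF (fun t x => f t x * g t x) :=
  ContDiff.mul hf hg

theorem const (a : ℝ) : SmF (fun _ _ => a) := contDiff_const

theorem affine (hf : SmF f) (a b : ℝ) : SmF (fun t x => affc a b (f t x)) := by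
  unfold affc
  exact (hf.mul (const a)).add (((const 1).sub hf).mul (const b))

theorem contX (hf : SmF f) (t : ℝ) : Continuous (fun x => f t x) :=
  hf.cont.comp (Continuous.prodMk_right t)

theorem contInt (hf : SmF f) : Continuous (fun t => ∫ x in (0:ℝ)..1, f t x) :=
  intervalIntegral.continuous_parametric_intervalIntegral_of_continuous' hf.cont 0 1

theorem hasDerivInt (hf : SmF f) (t : ℝ) :
    HasDerivAt (fun s => ∫ x in (0:ℝ)..1, f s x) (∫ x in (0:ℝ)..1, pdt f t x) t := by
  have hK : IsCompact (Icc (t-1) (t+1) ×ˢ Icc (0:ℝ) 1) := isCompact_Icc.prod isCompact_Icc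
  obtain ⟨B, hB⟩ := hK.exists_bound_of_continuousOn hf.smPdt.cont.continuousOn
  refine (intervalIntegral.hasDerivAt_integral_of_dominated_loc_of_deriv_le
    (F := f) (F' := pdt f) (bound := fun _ => B) (s := Icc (t-1) (t+1))
    (Icc_mem_nhds (by linarith) (by linarith)) ?_ ?_ ?_ ?_ ?_ ?_).2
  · exact Filter.Eventually.of_forall fun s => (hf.contX s).aestronglyMeasurable
  · exact (hf.contX t).intervalIntegrable _ _
  · exact (hf.smPdt.contX t).aestronglyMeasurable
  · refine Filter.Eventually.of_forall fun x hx s hs => hB (s, x) ⟨hs, ?_⟩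
    rw [uIoc_of_le zero_le_one] at hx
    exact Ioc_subset_Icc_self hx
  · exact intervalIntegrable_const
  · exact Filter.Eventually.of_forall fun x _ s _ => hf.hdt s x

theorem int_pdx (hf : SmF f) (hp : ∀ t x, f t (x + 1) = f t x) (t : ℝ) :
    ∫ x in (0:ℝ)..1, pdx f t x = 0 := by
  rw [intervalIntegral.integral_eq_sub_of_hasDerivAt (f := fun x => f t x)
    (fun x _ => hf.hdx t x) ((hf.smPdx.contX t).intervalIntegrable _ _)]
  have := hp t 0
  rw [zero_add] at this
  simp [this]

theorem contSup (hf : SmF f) : Continuous (fun t => ⨆ x : Icc (0:ℝ) 1, |f t x.1|) := by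
  have h : Continuous fun t => sSup ((fun x => |f t x|) '' Icc (0:ℝ) 1) :=
    isCompact_Icc.continuous_sSup (f := fun t x => |f t x|) hf.cont.abs
  simpa only [sSup_image'] using h

theorem le_sup (hf : SmF f) (t : ℝ) {x : ℝ} (hx : x ∈ Icc (0:ℝ) 1) :
    |f t x| ≤ ⨆ x : Icc (0:ℝ) 1, |f t x.1| := by
  refine le_ciSup (f := fun x : Icc (0:ℝ) 1 => |f t x.1|) ?_ ⟨x, hx⟩
  have := (isCompact_Icc (a := (0:ℝ)) (b := 1)).bddAbove_image
    (hf.contX t).abs.continuousOn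
  rwa [image_eq_range] at this

end SmF

theorem per_pdt {f : ℝ → ℝ → ℝ} (hp : ∀ t x, f t (x + 1) = f t x) (t x : ℝ) :
    pdt f t (x + 1) = pdt f t x := by
  unfold pdt; simp only [hp]

theorem per_pdx {f : ℝ → ℝ → ℝ} (hp : ∀ t x, f t (x + 1) = f t x) (t x : ℝ) :
    pdx f t (x + 1) = pdx f t x := by
  unfold pdx
  rw [← deriv_comp_add_const]
  simp only [hp]

/-- The time-weighted integration step. -/
theorem weighted_step {T : ℝ} {G G' D g : ℝ → ℝ}
    (hG : ∀ t, HasDerivAt G (G' t) t) (hG' : Continuous G') (hD : Continuous D)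
    (hg : Continuous g) (hG0 : ∀ t ∈ Icc 0 T, 0 ≤ G t) (hg0 : ∀ t, 0 ≤ g t)
    (hle : ∀ t ∈ Ioo 0 T, G' t ≤ g t - D t) {t : ℝ} (ht : t ∈ Icc 0 T) :
    min 1 t * G t + ∫ s in (0:ℝ)..t, min 1 s * D s
      ≤ (∫ s in (0:ℝ)..T, G s) + ∫ s in (0:ℝ)..T, g s := by
  have hGc : Continuous G := continuous_iff_continuousAt.2 fun t => (hG t).continuousAt
  have hm : Continuous fun s : ℝ => min 1 s * D s := by fun_prop
  have key : ∀ r ∈ Icc 0 T, r ≤ 1 → r * G r + ∫ s in (0:ℝ)..r, min 1 s * D s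
      ≤ (∫ s in (0:ℝ)..r, G s) + ∫ s in (0:ℝ)..r, g s := by
    intro r hr hr1
    have e1 : ∫ s in (0:ℝ)..r, (1 * G s + s * G' s) = r * G r - 0 * G 0 :=
      intervalIntegral.integral_eq_sub_of_hasDerivAt (f := fun s => s * G s)
        (fun s _ => (hasDerivAt_id s).mul (hG s))
        (Continuous.intervalIntegrable (by fun_prop) _ _)
    have e2 : ∫ s in (0:ℝ)..r, ((1 * G s + s * G' s) + min 1 s * D s)
        ≤ ∫ s in (0:ℝ)..r, (G s + g s) := by
      apply intervalIntegral.integral_mono_on_of_le_Ioo hr.1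
        (Continuous.intervalIntegrable (by fun_prop) _ _)
        (Continuous.intervalIntegrable (by fun_prop) _ _)
      intro s hs
      have h1 := hle s ⟨hs.1, hs.2.trans_le hr.2⟩
      rw [min_eq_right (hs.2.le.trans hr1)]
      have h2 := mul_le_mul_of_nonneg_left h1 hs.1.le
      have h3 := mul_le_mul_of_nonneg_right (hs.2.le.trans hr1) (hg0 s)
      linarith
    rw [intervalIntegral.integral_add (Continuous.intervalIntegrable (by fun_prop) _ _)
      (Continuous.intervalIntegrable (by fun_prop) _ _), e1,
      intervalIntegral.integral_add (Continuous.intervalIntegrable (by fun_prop) _ _)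
      (Continuous.intervalIntegrable (by fun_prop) _ _)] at e2
    linarith
  have mono : ∀ (F : ℝ → ℝ), Continuous F → (∀ s ∈ Icc 0 T, 0 ≤ F s) → ∀ r ∈ Icc 0 T,
      ∫ s in (0:ℝ)..r, F s ≤ ∫ s in (0:ℝ)..T, F s := by
    intro F hF hF0 r hr
    rw [← intervalIntegral.integral_add_adjacent_intervals (b := r)
      (hF.intervalIntegrable 0 r) (hF.intervalIntegrable r T)]
    have := intervalIntegral.integral_nonneg (μ := volume) hr.2
      (fun s hs => hF0 s ⟨hr.1.trans hs.1, hs.2⟩)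
    linarith
  rcases le_or_gt t 1 with h | h
  · rw [min_eq_right h]
    have := key t ht h
    have := mono G hGc hG0 t ht
    have := mono g hg (fun s _ => hg0 s) t ht
    linarith
  · rw [min_eq_left h.le]
    have h1T : (1:ℝ) ∈ Icc 0 T := ⟨zero_le_one, h.le.trans ht.2⟩
    have k1 := key 1 h1T le_rfl
    have e1 : ∫ s in (1:ℝ)..t, G' s = G t - G 1 :=
      intervalIntegral.integral_eq_sub_of_hasDerivAt (fun s _ => hG s)
        (hG'.intervalIntegrable _ _)
    have e2 : ∫ s in (1:ℝ)..t, (G' s + min 1 s * D s) ≤ ∫ s in (1:ℝ)..t, g s := by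
      apply intervalIntegral.integral_mono_on_of_le_Ioo h.le
        (Continuous.intervalIntegrable (by fun_prop) _ _)
        (Continuous.intervalIntegrable (by fun_prop) _ _)
      intro s hs
      have h1 := hle s ⟨zero_lt_one.trans hs.1, hs.2.trans_le ht.2⟩
      rw [min_eq_left hs.1.le]
      linarith
    rw [intervalIntegral.integral_add (Continuous.intervalIntegrable (by fun_prop) _ _)
      (Continuous.intervalIntegrable (by fun_prop) _ _), e1] at e2
    rw [← intervalIntegral.integral_add_adjacent_intervals (b := (1:ℝ))
      (hm.intervalIntegrable 0 1) (hm.intervalIntegrable 1 t)]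
    have a1 := intervalIntegral.integral_add_adjacent_intervals (b := (1:ℝ))
      (hg.intervalIntegrable (μ := volume) 0 1) (hg.intervalIntegrable 1 t)
    have := mono G hGc hG0 1 h1T
    have := mono g hg (fun s _ => hg0 s) t ht
    linarith

/-- Acceleration `v = ∂ₜu + u∂ₓu`. -/
noncomputable def acc (u : ℝ → ℝ → ℝ) (t x : ℝ) : ℝ := pdt u t x + u t x * pdx u t x

/-- Material derivative. -/
noncomputable def matD (u f : ℝ → ℝ → ℝ) (t x : ℝ) : ℝ := pdt f t x + u t x * pdx f t x

theorem SmF.sigm {c ρ θ u : ℝ → ℝ → ℝ} (μp μm γp γm : ℝ) (hc : SmF c) (hρ : SmF ρ)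
    (hθ : SmF θ) (hu : SmF u) : SmF (sigm μp μm γp γm c ρ θ u) :=
  ((hc.affine μp μm).mul hu.smPdx).sub
    ((((hc.affine γp γm).sub (SmF.const 1)).mul hρ).mul hθ)

theorem SmF.matD {f u : ℝ → ℝ → ℝ} (hu : SmF u) (hf : SmF f) : SmF (matD u f) :=
  hf.smPdt.add (hu.mul hf.smPdx)

theorem SmF.acc {u : ℝ → ℝ → ℝ} (hu : SmF u) : SmF (acc u) := hu.matD hu

theorem HasDerivAt.affc {f : ℝ → ℝ} {f' x : ℝ} (hf : HasDerivAt f f' x) (a b : ℝ) :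
    HasDerivAt (fun y => affc a b (f y)) (f' * (a - b)) x := by
  have := (hf.mul_const a).add (((hasDerivAt_const x (1:ℝ)).sub hf).mul_const b)
  convert! this using 1
  ring

theorem pointwise_mom {μp μm γp γm kp km T : ℝ} {c ρ θ u : ℝ → ℝ → ℝ}
    (hρ : SmF ρ) (hu : SmF u)
    (hE : MesoEqns μp μm γp γm kp km T c ρ θ u) {t : ℝ} (ht : t ∈ Icc 0 T) (x : ℝ) :
    pdx (sigm μp μm γp γm c ρ θ u) t x = ρ t x * acc u t x := by
  obtain ⟨-, -, -, -, -, hmass, hmom, -⟩ := hE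
  have e1 := hmass t ht x
  have e2 := hmom t ht x
  have d1 : pdx (fun s y => ρ s y * u s y) t x = _ := ((hρ.hdx t x).mul (hu.hdx t x)).deriv
  have d2 : pdt (fun s y => ρ s y * u s y) t x = _ := ((hρ.hdt t x).mul (hu.hdt t x)).deriv
  have d3 : pdx (fun s y => ρ s y * u s y ^ 2) t x = _ :=
    ((hρ.hdx t x).mul ((hu.hdx t x).pow 2)).deriv
  rw [d1] at e1
  rw [d2, d3] at e2
  rw [← e2]
  unfold acc
  simp only [Pi.pow_apply] at *
  push_cast
  linear_combination (u t x) * e1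

theorem pointwise_sig {μp μm γp γm kp km T : ℝ} {c ρ θ u : ℝ → ℝ → ℝ}
    (hc : SmF c) (hρ : SmF ρ) (hθ : SmF θ) (hu : SmF u)
    (hE : MesoEqns μp μm γp γm kp km T c ρ θ u) {t : ℝ} (ht : t ∈ Icc 0 T) (x : ℝ)
    (hk : affc kp km (c t x) ≠ 0) :
    matD u (sigm μp μm γp γm c ρ θ u) t x = affc μp μm (c t x) * pdx (acc u) t x
      - ((affc γp γm (c t x) - 1) / affc kp km (c t x) + 1)
        * sigm μp μm γp γm c ρ θ u t x * pdx u t x := by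
  have hmm := pointwise_mom hρ hu hE ht x
  have hσ := SmF.sigm μp μm γp γm hc hρ hθ hu
  obtain ⟨-, -, -, -, htr, hmass, -, hen⟩ := hE
  have e0 := htr t ht x
  have e1 := hmass t ht x
  have e3 := hen t ht x
  have d1 : pdx (fun s y => ρ s y * u s y) t x = _ := ((hρ.hdx t x).mul (hu.hdx t x)).deriv
  rw [d1] at e1
  have dEt : HasDerivAt (fun s => Etot kp km c θ u s x)
      (u t x * pdt u t x + (pdt c t x * (kp - km) * θ t x + affc kp km (c t x) * pdt θ t x)) t := by
    have := (((hu.hdt t x).pow 2).div_const 2).add (((hc.hdt t x).affc kp km).mul (hθ.hdt t x))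
    convert! this using 1
    push_cast; ring
  have dEx : HasDerivAt (fun y => Etot kp km c θ u t y)
      (u t x * pdx u t x + (pdx c t x * (kp - km) * θ t x + affc kp km (c t x) * pdx θ t x)) x := by
    have := (((hu.hdx t x).pow 2).div_const 2).add (((hc.hdx t x).affc kp km).mul (hθ.hdx t x))
    convert! this using 1
    push_cast; ring
  have d4 : pdt (fun s y => ρ s y * Etot kp km c θ u s y) t x = _ :=
    ((hρ.hdt t x).mul dEt).deriv
  have d5 : pdx (fun s y => ρ s y * Etot kp km c θ u s y * u s y) t x = _ :=
    (((hρ.hdx t x).fun_mul dEx).fun_mul (hu.hdx t x)).deriv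
  have d6 : pdx (fun s y => sigm μp μm γp γm c ρ θ u s y * u s y) t x = _ :=
    ((hσ.hdx t x).mul (hu.hdx t x)).deriv
  rw [d4, d5, d6, hmm] at e3
  unfold acc at e3
  have e4 : ρ t x * affc kp km (c t x) * (pdt θ t x + u t x * pdx θ t x)
      = sigm μp μm γp γm c ρ θ u t x * pdx u t x := by
    linear_combination e3 - Etot kp km c θ u t x * e1
      - ρ t x * (kp - km) * θ t x * e0
  have d7 : pdx (acc u) t x = _ :=
    ((hu.smPdt.hdx t x).add ((hu.hdx t x).mul (hu.smPdx.hdx t x))).deriv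
  have d8 : pdt (sigm μp μm γp γm c ρ θ u) t x = _ :=
    ((((hc.hdt t x).affc μp μm).fun_mul (hu.smPdx.hdt t x)).fun_sub
      (((((hc.hdt t x).affc γp γm).sub_const 1).fun_mul (hρ.hdt t x)).fun_mul
        (hθ.hdt t x))).deriv
  have d9 : pdx (sigm μp μm γp γm c ρ θ u) t x = _ :=
    ((((hc.hdx t x).affc μp μm).fun_mul (hu.smPdx.hdx t x)).fun_sub
      (((((hc.hdx t x).affc γp γm).sub_const 1).fun_mul (hρ.hdx t x)).fun_mul
        (hθ.hdx t x))).deriv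
  have es : sigm μp μm γp γm c ρ θ u t x = affc μp μm (c t x) * pdx u t x
    - (affc γp γm (c t x) - 1) * ρ t x * θ t x := rfl
  unfold matD
  rw [d7, d8, d9, hu.pdt_pdx]
  generalize sigm μp μm γp γm c ρ θ u t x = σ at *
  generalize affc μp μm (c t x) = m at *
  generalize affc γp γm (c t x) = g at *
  generalize affc kp km (c t x) = k at *
  have e5 : ρ t x * (pdt θ t x + u t x * pdx θ t x) = σ * pdx u t x / k := by
    rw [eq_div_iff hk]; linear_combination e4
  have e6 : ((g - 1) / k + 1) * σ * pdx u t x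
      = (g - 1) * (σ * pdx u t x / k) + σ * pdx u t x := by ring
  rw [e6, ← e5, es]
  linear_combination (pdx u t x * (μp - μm) - (γp - γm) * ρ t x * θ t x) * e0
    - (g - 1) * θ t x * e1

theorem pointwise_energy {μp μm γp γm kp km T : ℝ} {c ρ θ u : ℝ → ℝ → ℝ}
    (hc : SmF c) (hρ : SmF ρ) (hθ : SmF θ) (hu : SmF u)
    (hE : MesoEqns μp μm γp γm kp km T c ρ θ u) {t : ℝ} (ht : t ∈ Ioo 0 T) (x : ℝ) :
    pdt (fun s y => ρ s y * acc u s y ^ 2) t x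
      = pdx (fun s y => 2 * acc u s y * matD u (sigm μp μm γp γm c ρ θ u) s y
          - ρ s y * u s y * acc u s y ^ 2) t x
        - 2 * pdx (acc u) t x * matD u (sigm μp μm γp γm c ρ θ u) t x := by
  have hσ := SmF.sigm μp μm γp γm hc hρ hθ hu
  have hm : ∀ s ∈ Icc 0 T, ∀ y, _ := fun s hs y => pointwise_mom hρ hu hE hs y
  have ht' := Ioo_subset_Icc_self ht
  obtain ⟨-, -, -, -, -, hmass, -, -⟩ := hE
  have e1 := hmass t ht' x
  have d1 : pdx (fun s y => ρ s y * u s y) t x = _ := ((hρ.hdx t x).mul (hu.hdx t x)).deriv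
  rw [d1] at e1
  generalize sigm μp μm γp γm c ρ θ u = σ at *
  have hS : SmF (matD u σ) := hu.matD hσ
  have hv : SmF (acc u) := hu.acc
  have e2 : pdx (pdx σ) t x = pdx ρ t x * acc u t x + ρ t x * pdx (acc u) t x := by
    have : (fun y => pdx σ t y) = fun y => ρ t y * acc u t y := funext fun y => hm t ht' y
    have h2 : pdx (pdx σ) t x = deriv (fun y => ρ t y * acc u t y) x := by rw [← this]; rfl
    rw [h2]
    exact ((hρ.hdx t x).mul (hv.hdx t x)).deriv
  have e3 : pdx (pdt σ) t x = pdt ρ t x * acc u t x + ρ t x * pdt (acc u) t x := by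
    rw [← hσ.pdt_pdx]
    have h2 : pdt (pdx σ) t x = deriv (fun s => ρ s x * acc u s x) t := by
      apply Filter.EventuallyEq.deriv_eq
      filter_upwards [Ioo_mem_nhds ht.1 ht.2] with s hs
      exact hm s (Ioo_subset_Icc_self hs) x
    rw [h2]
    exact ((hρ.hdt t x).mul (hv.hdt t x)).deriv
  have e4 : pdx (matD u σ) t x = _ :=
    ((hσ.smPdt.hdx t x).add ((hu.hdx t x).mul (hσ.smPdx.hdx t x))).deriv
  rw [e2, e3, hm t ht' x] at e4
  have d2 : pdt (fun s y => ρ s y * acc u s y ^ 2) t x = _ :=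
    ((hρ.hdt t x).fun_mul ((hv.hdt t x).fun_pow 2)).deriv
  have d3 : pdx (fun s y => 2 * acc u s y * matD u σ s y
          - ρ s y * u s y * acc u s y ^ 2) t x = _ :=
    ((((hv.hdx t x).const_mul 2).fun_mul (hS.hdx t x)).fun_sub
      (((hρ.hdx t x).fun_mul (hu.hdx t x)).fun_mul ((hv.hdx t x).fun_pow 2))).deriv
  rw [d2, d3, e4]
  push_cast
  linear_combination (- acc u t x ^ 2) * e1

theorem affc_bd {a b s : ℝ} (hs : s ∈ Icc (0:ℝ) 1) :
    min a b ≤ affc a b s ∧ affc a b s ≤ max a b := by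
  obtain ⟨h0, h1⟩ := hs
  have h1' : 0 ≤ 1 - s := by linarith
  unfold affc
  have e1 := mul_le_mul_of_nonneg_left (min_le_left a b) h0
  have e2 := mul_le_mul_of_nonneg_left (min_le_right a b) h1'
  have e3 := mul_le_mul_of_nonneg_left (le_max_left a b) h0
  have e4 := mul_le_mul_of_nonneg_left (le_max_right a b) h1'
  constructor <;> linarith

theorem affc_pos {a b s : ℝ} (ha : 0 < a) (hb : 0 < b) (hs : s ∈ Icc (0:ℝ) 1) :
    0 < affc a b s := (lt_min ha hb).trans_le (affc_bd hs).1

/-- Algebraic core of the dissipation estimate. -/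
theorem diss_alg {m M μ a A σ w q vx S : ℝ} (hm : 0 < m) (h1 : m ≤ μ) (h2 : μ ≤ M)
    (ha0 : 0 ≤ a) (ha1 : a ≤ A) (hq : w ^ 2 ≤ q ^ 2) (hS : S = μ * vx - a * σ * w) :
    -(2 * vx * S) ≤ A ^ 2 / m * q ^ 2 * σ ^ 2 - 1 / M * S ^ 2 := by
  have hμ : 0 < μ := hm.trans_le h1
  have hvx : vx = (S + a * σ * w) / μ := by
    rw [eq_div_iff hμ.ne', hS]; ring
  have e1 : -(2 * vx * S) ≤ a ^ 2 * w ^ 2 * σ ^ 2 / μ - S ^ 2 / μ := by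
    rw [hvx, ← sub_nonneg]
    have : a ^ 2 * w ^ 2 * σ ^ 2 / μ - S ^ 2 / μ - -(2 * ((S + a * σ * w) / μ) * S)
        = (S + a * σ * w) ^ 2 / μ := by ring
    rw [this]
    positivity
  have e2 : a ^ 2 * w ^ 2 * σ ^ 2 / μ ≤ A ^ 2 * q ^ 2 * σ ^ 2 / m := by
    apply div_le_div₀ (by positivity) _ hm h1
    gcongr
  have e3 : S ^ 2 / M ≤ S ^ 2 / μ := div_le_div_of_nonneg_left (sq_nonneg _) hμ h2
  have e4 : A ^ 2 / m * q ^ 2 * σ ^ 2 - 1 / M * S ^ 2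
      = A ^ 2 * q ^ 2 * σ ^ 2 / m - S ^ 2 / M := by ring
  rw [e4]
  linarith

/-- Hoff's weighted higher-regularity estimate: there is
`C₁₁ > 0`, depending only on `μ_±, γ_±, c_{v,±}, ρ̲, ρ̄, C₅, C₉`, such that every
smooth solution satisfying the basic stress and velocity-gradient estimates obeys
`min(1,t)∫₀¹(∂ₓσ(t))² + ∫₀ᵗ min(1,s)∫₀¹(D_tσ)² ≤ C₁₁` on `[0,T]`,
where `D_tσ = ∂ₜσ + u∂ₓσ` and `κ(t) = min(1,t)` is Hoff's time weight. -/
theorem stmt13 (μp μm γp γm kp km ρlo ρbar C5 C9 : ℝ)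
    (hconst : GoodConsts μp μm γp γm kp km)
    (hρlo : 0 < ρlo) (hρ : ρlo ≤ ρbar) (hC5 : 0 < C5) (hC9 : 0 < C9) :
    ∃ C11 > (0:ℝ), ∀ T : ℝ, 0 < T → ∀ c ρ θ u : ℝ → ℝ → ℝ,
      ContDiff ℝ (⊤ : ℕ∞) (uncurry c) → ContDiff ℝ (⊤ : ℕ∞) (uncurry ρ) →
      ContDiff ℝ (⊤ : ℕ∞) (uncurry θ) → ContDiff ℝ (⊤ : ℕ∞) (uncurry u) →
      (∀ t ∈ Icc (0:ℝ) T, ∀ x : ℝ,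
        c t x ∈ Icc (0:ℝ) 1 ∧ ρlo ≤ ρ t x ∧ ρ t x ≤ ρbar ∧ 0 < θ t x) →
      MesoEqns μp μm γp γm kp km T c ρ θ u →
      (∀ t ∈ Icc (0:ℝ) T,
        (∫ x in (0:ℝ)..1, (sigm μp μm γp γm c ρ θ u t x) ^ 2)
          + (∫ s in (0:ℝ)..T, ∫ x in (0:ℝ)..1,
              (pdx (sigm μp μm γp γm c ρ θ u) s x) ^ 2) ≤ C5) →
      (∫ t in (0:ℝ)..T, (⨆ x : Icc (0:ℝ) 1, |pdx u t x.1|) ^ 2) ≤ C9 →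
      ∀ t ∈ Icc (0:ℝ) T,
        min 1 t * (∫ x in (0:ℝ)..1, (pdx (sigm μp μm γp γm c ρ θ u) t x) ^ 2)
          + (∫ s in (0:ℝ)..t, min 1 s * ∫ x in (0:ℝ)..1,
              (pdt (sigm μp μm γp γm c ρ θ u) s x
                + u s x * pdx (sigm μp μm γp γm c ρ θ u) s x) ^ 2)
          ≤ C11 := by
  obtain ⟨hμp, hμm, hγp, hγm, hkp, hkm⟩ := hconst
  have hρbar : 0 < ρbar := hρlo.trans_le hρ
  have hm0 : 0 < min μp μm := lt_min hμp hμm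
  have hM0 : 0 < max μp μm := lt_max_of_lt_left hμp
  have hk0 : 0 < min kp km := lt_min hkp hkm
  set m := min μp μm with hm
  set M := max μp μm with hM
  set A := max γp γm / min kp km + 1 with hA
  have hA0 : 0 < A := by
    have : 0 < max γp γm := lt_max_of_lt_left (by linarith)
    positivity
  set B := C5 / ρlo + A ^ 2 / m * C5 * C9 with hB
  have hB0 : 0 < B := by positivity
  refine ⟨(ρbar + M) * B, by positivity, ?_⟩
  intro T hT c ρ θ u hc hρs hθ hu hbd hE h5 h9 t ht
  have hc : SmF c := hc
  have hρs : SmF ρ := hρs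
  have hθ : SmF θ := hθ
  have hu : SmF u := hu
  have hσ : SmF (sigm μp μm γp γm c ρ θ u) := SmF.sigm μp μm γp γm hc hρs hθ hu
  have hv : SmF (acc u) := hu.acc
  have hS : SmF (matD u (sigm μp μm γp γm c ρ θ u)) := hu.matD hσ
  have hmom : ∀ s ∈ Icc 0 T, ∀ y, _ := fun s hs y => pointwise_mom hρs hu hE hs y
  have hen : ∀ s ∈ Ioo 0 T, ∀ y, _ := fun s hs y => pointwise_energy hc hρs hθ hu hE hs y
  have hsig : ∀ s ∈ Icc 0 T, ∀ y, _ := fun s hs y => pointwise_sig hc hρs hθ hu hE hs y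
    (affc_pos hkp hkm (hbd s hs y).1).ne'
  have hσper : ∀ t x, sigm μp μm γp γm c ρ θ u t (x + 1) = sigm μp μm γp γm c ρ θ u t x := by
    intro t x
    unfold sigm
    rw [per_pdx hE.2.2.2.1, hE.1, hE.2.1, hE.2.2.1]
  have hρper := hE.2.1
  have huper := hE.2.2.2.1
  set σ := sigm μp μm γp γm c ρ θ u with hσdef
  clear_value σ
  set q : ℝ → ℝ := fun t => ⨆ x : Icc (0:ℝ) 1, |pdx u t x.1| with hq
  have hqc : Continuous q := hu.smPdx.contSup
  -- pointwise dissipation inequality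
  have hpt : ∀ s ∈ Icc 0 T, ∀ x ∈ Icc (0:ℝ) 1,
      - (2 * pdx (acc u) s x * matD u σ s x)
        ≤ A ^ 2 / m * q s ^ 2 * σ s x ^ 2 - 1 / M * matD u σ s x ^ 2 := by
    intro s hs x hx
    have h1 := hsig s hs x
    obtain ⟨hcI, -, -, -⟩ := hbd s hs x
    have hμ1 : m ≤ affc μp μm (c s x) := (affc_bd hcI).1
    have hμ2 : affc μp μm (c s x) ≤ M := (affc_bd hcI).2
    have hγ1 : 0 ≤ affc γp γm (c s x) - 1 := by
      have := (affc_bd (a := γp) (b := γm) hcI).1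
      have := lt_min hγp hγm
      linarith
    have hγ2 : affc γp γm (c s x) ≤ max γp γm := (affc_bd hcI).2
    have hk1 : min kp km ≤ affc kp km (c s x) := (affc_bd hcI).1
    have ha0 : 0 ≤ (affc γp γm (c s x) - 1) / affc kp km (c s x) + 1 := by
      have := hk0.trans_le hk1
      positivity
    have ha1 : (affc γp γm (c s x) - 1) / affc kp km (c s x) + 1 ≤ A := by
      have : (affc γp γm (c s x) - 1) / affc kp km (c s x) ≤ max γp γm / min kp km :=
        div_le_div₀ (by linarith) (by linarith) hk0 hk1
      linarith
    have hux : pdx u s x ^ 2 ≤ q s ^ 2 := by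
      rw [← sq_abs (pdx u s x)]
      exact pow_le_pow_left₀ (abs_nonneg _) (hu.smPdx.le_sup s hx) 2
    exact diss_alg hm0 hμ1 hμ2 ha0 ha1 hux h1
  have hG : SmF (fun s y => ρ s y * acc u s y ^ 2) := by
    simp only [pow_two]
    exact hρs.mul (hv.mul hv)
  have hσ2 : SmF (fun s y => σ s y ^ 2) := by
    simp only [pow_two]
    exact hσ.mul hσ
  have hS2 : SmF (fun s y => matD u σ s y ^ 2) := by
    simp only [pow_two]
    exact hS.mul hS
  have hσx2 : SmF (fun s y => pdx σ s y ^ 2) := by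
    simp only [pow_two]
    exact hσ.smPdx.mul hσ.smPdx
  have hW : SmF (fun s y => 2 * acc u s y * matD u σ s y - ρ s y * u s y * acc u s y ^ 2) := by
    simp only [pow_two]
    exact (((SmF.const 2).mul hv).mul hS).sub ((hρs.mul hu).mul (hv.mul hv))
  have hvS : SmF (fun s y => 2 * pdx (acc u) s y * matD u σ s y) :=
    ((SmF.const 2).mul hv.smPdx).mul hS
  have hWper : ∀ t x, (fun s y => 2 * acc u s y * matD u σ s y
      - ρ s y * u s y * acc u s y ^ 2) t (x + 1) = (fun s y => 2 * acc u s y * matD u σ s y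
      - ρ s y * u s y * acc u s y ^ 2) t x := by
    intro t x
    simp only [acc, matD]
    rw [per_pdx huper, per_pdt huper, per_pdx hσper, per_pdt hσper, huper, hρper]
  have hnn5 : 0 ≤ ∫ s in (0:ℝ)..T, ∫ x in (0:ℝ)..1, (pdx σ s x) ^ 2 :=
    intervalIntegral.integral_nonneg hT.le fun s _ =>
      intervalIntegral.integral_nonneg zero_le_one fun x _ => sq_nonneg _
  have hle : ∀ s ∈ Ioo 0 T, (∫ x in (0:ℝ)..1, pdt (fun s y => ρ s y * acc u s y ^ 2) s x)
      ≤ A ^ 2 / m * C5 * q s ^ 2 - 1 / M * ∫ x in (0:ℝ)..1, matD u σ s x ^ 2 := by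
    intro s hs
    have hs' := Ioo_subset_Icc_self hs
    have i1 : (∫ x in (0:ℝ)..1, pdt (fun s y => ρ s y * acc u s y ^ 2) s x)
        = ∫ x in (0:ℝ)..1, - (2 * pdx (acc u) s x * matD u σ s x) := by
      have := hW.int_pdx hWper s
      simp only [hen s hs]
      rw [intervalIntegral.integral_sub ((hW.smPdx.contX s).intervalIntegrable _ _)
        ((hvS.contX s).intervalIntegrable _ _), this, intervalIntegral.integral_neg]
      ring
    have i2 : (∫ x in (0:ℝ)..1, - (2 * pdx (acc u) s x * matD u σ s x))
        ≤ ∫ x in (0:ℝ)..1, (A ^ 2 / m * q s ^ 2 * σ s x ^ 2 - 1 / M * matD u σ s x ^ 2) := by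
      apply intervalIntegral.integral_mono_on zero_le_one
      · exact (hvS.contX s).neg.intervalIntegrable _ _
      · exact (((hσ2.contX s).const_mul _).sub
          ((hS2.contX s).const_mul _)).intervalIntegrable _ _
      · exact hpt s hs'
    rw [intervalIntegral.integral_sub (((hσ2.contX s).const_mul _).intervalIntegrable _ _)
      (((hS2.contX s).const_mul _).intervalIntegrable _ _),
      intervalIntegral.integral_const_mul, intervalIntegral.integral_const_mul] at i2
    have i3 : ∫ x in (0:ℝ)..1, σ s x ^ 2 ≤ C5 := by
      have := h5 s hs'
      linarith
    have i4 := mul_le_mul_of_nonneg_left i3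
      (show 0 ≤ A ^ 2 / m * q s ^ 2 by positivity)
    rw [i1]
    linarith
  have hvv : ∀ s ∈ Icc 0 T, ∀ x, pdx σ s x ^ 2 = ρ s x * (ρ s x * acc u s x ^ 2) := by
    intro s hs x
    rw [hmom s hs x]; ring
  have hG0 : ∀ s ∈ Icc 0 T, ∀ x, 0 ≤ ρ s x * acc u s x ^ 2 := by
    intro s hs x
    have := hρlo.trans_le (hbd s hs x).2.1
    positivity
  have key := weighted_step (T := T) (G := fun s => ∫ x in (0:ℝ)..1, ρ s x * acc u s x ^ 2)
    (D := fun s => 1 / M * ∫ x in (0:ℝ)..1, matD u σ s x ^ 2)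
    (g := fun s => A ^ 2 / m * C5 * q s ^ 2)
    (fun s => hG.hasDerivInt s) hG.smPdt.contInt (hS2.contInt.const_mul _)
    ((hqc.pow 2).const_mul _)
    (fun s hs => intervalIntegral.integral_nonneg zero_le_one fun x _ => hG0 s hs x)
    (fun s => by positivity) hle ht
  -- bound the right-hand side
  have r1 : ∫ s in (0:ℝ)..T, ∫ x in (0:ℝ)..1, ρ s x * acc u s x ^ 2 ≤ C5 / ρlo := by
    have j1 : ∫ s in (0:ℝ)..T, ∫ x in (0:ℝ)..1, ρ s x * acc u s x ^ 2
        ≤ ∫ s in (0:ℝ)..T, 1 / ρlo * ∫ x in (0:ℝ)..1, pdx σ s x ^ 2 := by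
      apply intervalIntegral.integral_mono_on hT.le
      · exact hG.contInt.intervalIntegrable _ _
      · exact (hσx2.contInt.const_mul _).intervalIntegrable _ _
      · intro s hs
        rw [← intervalIntegral.integral_const_mul]
        apply intervalIntegral.integral_mono_on zero_le_one
        · exact (hG.contX s).intervalIntegrable _ _
        · exact ((hσx2.contX s).const_mul _).intervalIntegrable _ _
        · intro x _
          rw [hvv s hs x, one_div, ← div_eq_inv_mul, le_div_iff₀ hρlo, mul_comm]
          exact mul_le_mul_of_nonneg_right (hbd s hs x).2.1 (hG0 s hs x)
    rw [intervalIntegral.integral_const_mul] at j1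
    have j2 : ∫ s in (0:ℝ)..T, ∫ x in (0:ℝ)..1, pdx σ s x ^ 2 ≤ C5 := by
      have := h5 t ht
      have : 0 ≤ ∫ x in (0:ℝ)..1, σ t x ^ 2 :=
        intervalIntegral.integral_nonneg zero_le_one fun x _ => sq_nonneg _
      linarith
    refine j1.trans ?_
    rw [one_div, ← div_eq_inv_mul]
    exact div_le_div_of_nonneg_right j2 hρlo.le
  have r2 : ∫ s in (0:ℝ)..T, A ^ 2 / m * C5 * q s ^ 2 ≤ A ^ 2 / m * C5 * C9 := by
    rw [intervalIntegral.integral_const_mul]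
    exact mul_le_mul_of_nonneg_left h9 (by positivity)
  have hκ : 0 ≤ min 1 t := le_min zero_le_one ht.1
  have l1 : ∫ x in (0:ℝ)..1, pdx σ t x ^ 2
      ≤ ρbar * ∫ x in (0:ℝ)..1, ρ t x * acc u t x ^ 2 := by
    rw [← intervalIntegral.integral_const_mul]
    apply intervalIntegral.integral_mono_on zero_le_one
    · exact (hσx2.contX t).intervalIntegrable _ _
    · exact ((hG.contX t).const_mul _).intervalIntegrable _ _
    · intro x _
      rw [hvv t ht x]
      exact mul_le_mul_of_nonneg_right (hbd t ht x).2.2.1 (hG0 t ht x)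
  have l2 : ∫ s in (0:ℝ)..t, min 1 s * (1 / M * ∫ x in (0:ℝ)..1, matD u σ s x ^ 2)
      = 1 / M * ∫ s in (0:ℝ)..t, min 1 s * ∫ x in (0:ℝ)..1, matD u σ s x ^ 2 := by
    rw [← intervalIntegral.integral_const_mul]
    congr 1
    funext s
    ring
  simp only [l2] at key
  change min 1 t * (∫ x in (0:ℝ)..1, pdx σ t x ^ 2)
    + (∫ s in (0:ℝ)..t, min 1 s * ∫ x in (0:ℝ)..1, matD u σ s x ^ 2) ≤ (ρbar + M) * B
  have n1 : 0 ≤ ∫ x in (0:ℝ)..1, ρ t x * acc u t x ^ 2 :=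
    intervalIntegral.integral_nonneg zero_le_one fun x _ => hG0 t ht x
  have n2 : 0 ≤ ∫ s in (0:ℝ)..t, min 1 s * ∫ x in (0:ℝ)..1, matD u σ s x ^ 2 :=
    intervalIntegral.integral_nonneg ht.1 fun s hs =>
      mul_nonneg (le_min zero_le_one hs.1)
        (intervalIntegral.integral_nonneg zero_le_one fun x _ => sq_nonneg _)
  generalize (∫ s in (0:ℝ)..t, min 1 s * ∫ x in (0:ℝ)..1, matD u σ s x ^ 2) = Z at *
  generalize (∫ x in (0:ℝ)..1, ρ t x * acc u t x ^ 2) = Y at *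
  generalize (∫ x in (0:ℝ)..1, pdx σ t x ^ 2) = X at *
  have f0 : min 1 t * Y + 1 / M * Z ≤ B := by linarith
  have f1 : 0 ≤ min 1 t * Y := mul_nonneg hκ n1
  have f2 : 0 ≤ 1 / M * Z := by positivity
  have f3 : min 1 t * X ≤ ρbar * B := by
    have g1 := mul_le_mul_of_nonneg_left l1 hκ
    have g2 := mul_le_mul_of_nonneg_left (show min 1 t * Y ≤ B by linarith) hρbar.le
    linarith
  have f4 : Z ≤ M * B := by
    have g1 := mul_le_mul_of_nonneg_left (show 1 / M * Z ≤ B by linarith) hM0.le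
    rwa [← mul_assoc, mul_one_div_cancel hM0.ne', one_mul] at g1
  linarith
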